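/- For every n ≥ 1, the number of 321-avoiding involutions in S_n equals the central binomial coefficient C(n, ⌊n/2⌋). -/

import Mathlib

/-- `w` is a permutation of `{1,…,n}` (i.e. fixes every point outside `{1,…,n}`)
which is an involution: `w² = 1`. -/
def IsInvolutionOn (n : ℕ) (w : Equiv.Perm ℕ) : Prop :=
  (∀ k : ℕ, w k ≠ k → 1 ≤ k ∧ k ≤ n) ∧ w * w = 1

/-- `w ∈ S_n` is 321-avoiding: there are no indices `1 ≤ p < q < r ≤ n` with
`w(p) > w(q) > w(r)`. -/
def Avoids321 (n : ℕ) (w : Equiv.Perm ℕ) : Prop :=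
  ∀ p q r : ℕ, 1 ≤ p → p < q → q < r → r ≤ n → ¬ (w q < w p ∧ w r < w q)

/-- `mi n` is the number of 321-avoiding involutions in `S_n`. -/
noncomputable def mi (n : ℕ) : ℕ :=
  Set.ncard {w : Equiv.Perm ℕ | IsInvolutionOn n w ∧ Avoids321 n w}

open Equiv

/-- Number of completions of length `n` starting from `h` pending openers. -/
def gcount : ℕ → ℕ → ℕ
  | 0, 0 => 1
  | 0, _ + 1 => 0
  | n + 1, 0 => gcount n 1 + gcount n 0
  | n + 1, h + 1 => gcount n (h + 2) + gcount n h

theorem gcount_eq (n : ℕ) : ∀ h : ℕ,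
    gcount n h = if h ≤ n then Nat.choose n ((n - h) / 2) else 0 := by
  induction n with
  | zero =>
    intro h
    cases h <;> simp [gcount]
  | succ n ih =>
    intro h
    cases h with
    | zero =>
      simp only [gcount, ih]
      obtain ⟨k, hk | hk⟩ : ∃ k, n = 2 * k ∨ n = 2 * k + 1 := ⟨n / 2, by omega⟩
      · subst hk
        cases k with
        | zero => simp
        | succ k =>
          have h1 : (2 * (k + 1) - 1) / 2 = k := by omega
          have h2 : (2 * (k + 1) - 0) / 2 = k + 1 := by omega
          have h3 : (2 * (k + 1) + 1 - 0) / 2 = k + 1 := by omega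
          rw [h1, h2, h3, if_pos (by omega), if_pos (by omega), if_pos (by omega),
            Nat.choose_succ_succ]
      · subst hk
        have h1 : (2 * k + 1 - 1) / 2 = k := by omega
        have h2 : (2 * k + 1 - 0) / 2 = k := by omega
        have h3 : (2 * k + 1 + 1 - 0) / 2 = k + 1 := by omega
        rw [h1, h2, h3, if_pos (by omega), if_pos (by omega), if_pos (by omega),
          Nat.choose_succ_succ, Nat.choose_symm_half]
    | succ h =>
      simp only [gcount, ih]
      by_cases h1 : h + 2 ≤ n
      · have e1 : (n - h) / 2 = (n - (h + 2)) / 2 + 1 := by omega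
        have e2 : (n + 1 - (h + 1)) / 2 = (n - (h + 2)) / 2 + 1 := by omega
        rw [if_pos h1, if_pos (by omega), if_pos (by omega), e1, e2, Nat.choose_succ_succ]
      · by_cases h2 : h ≤ n
        · have e1 : (n - h) / 2 = 0 := by omega
          have e2 : (n + 1 - (h + 1)) / 2 = 0 := by omega
          rw [if_neg h1, if_pos h2, if_pos (by omega), e1, e2]
          simp
        · rw [if_neg h1, if_neg h2, if_neg (by omega)]

/-- Involutions living on `A ∪ {m+1,…,N}`, sending `A` beyond `m`, nonnesting. -/
def PP (A : Finset ℕ) (m N : ℕ) (w : Equiv.Perm ℕ) : Prop :=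
  (∀ x, w (w x) = x) ∧ (∀ x, w x ≠ x → x ∈ A ∨ (m < x ∧ x ≤ N)) ∧
  (∀ a ∈ A, m < w a) ∧
  (∀ a b, (b ∈ A ∨ (m < b ∧ b ≤ N)) → a < b → b ≤ w b → w a ≤ w b)

theorem PP_open {A : Finset ℕ} {m N : ℕ} (hN : m + 1 ≤ N) (w : Equiv.Perm ℕ)
    (hA : ∀ a ∈ A, a ≤ m) :
    PP (insert (m + 1) A) (m + 1) N w ↔ PP A m N w ∧ m + 1 < w (m + 1) := by
  have key : ∀ x, (x ∈ insert (m + 1) A ∨ (m + 1 < x ∧ x ≤ N)) ↔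
      (x ∈ A ∨ (m < x ∧ x ≤ N)) := by
    intro x
    rw [Finset.mem_insert]
    by_cases hx : x ∈ A
    · simp [hx]
    · simp only [hx, or_false, false_or]; omega
  unfold PP
  simp only [key]
  constructor
  · rintro ⟨h1, h2, h3, h4⟩
    refine ⟨⟨h1, h2, ?_, h4⟩, h3 _ (Finset.mem_insert_self _ _)⟩
    intro a ha
    have := h3 a (Finset.mem_insert_of_mem ha)
    omega
  · rintro ⟨⟨h1, h2, h3, h4⟩, h5⟩
    refine ⟨h1, h2, ?_, h4⟩
    intro a ha
    rcases Finset.mem_insert.1 ha with rfl | ha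
    · exact h5
    · have e1 := h3 a ha
      have e2 := hA a ha
      have e3 : w a ≠ m + 1 := by
        intro e
        have := h1 a
        rw [e] at this
        omega
      omega

theorem PP_fix {m N : ℕ} (hN : m + 1 ≤ N) (w : Equiv.Perm ℕ) :
    PP ∅ (m + 1) N w ↔ PP ∅ m N w ∧ ¬ m + 1 < w (m + 1) := by
  unfold PP
  simp only [Finset.notMem_empty, false_or, false_imp_iff, implies_true, true_and]
  constructor
  · rintro ⟨h1, h2, h4⟩
    have hf : w (m + 1) = m + 1 := by
      by_contra h
      have := h2 _ h
      omega
    refine ⟨⟨h1, fun x hx => ?_, ?_⟩, by omega⟩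
    · have := h2 x hx; omega
    · intro a b hb hab hbw
      rcases Nat.lt_or_ge (m + 1) b with h | h
      · exact h4 a b ⟨h, hb.2⟩ hab hbw
      · have : w a = a := by
          by_contra h'
          have := h2 _ h'
          omega
        omega
  · rintro ⟨⟨h1, h2, h4⟩, h5⟩
    have hf : w (m + 1) = m + 1 := by
      by_contra h
      have h6 : w (w (m + 1)) ≠ w (m + 1) := fun e => h (w.injective e)
      have := h2 _ h6
      omega
    refine ⟨h1, fun x hx => ?_, ?_⟩
    · have := h2 x hx
      have : x ≠ m + 1 := fun e => hx (e ▸ hf)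
      omega
    · intro a b hb hab hbw
      exact h4 a b (by omega) hab hbw

theorem PP_close {A : Finset ℕ} {m N a₀ : ℕ} (hN : m + 1 ≤ N) (w : Equiv.Perm ℕ)
    (hA : ∀ a ∈ A, a ≤ m) (ha : a₀ ∈ A) (hmin : ∀ a ∈ A, a₀ ≤ a) :
    PP (A.erase a₀) (m + 1) N (w * swap a₀ (m + 1)) ↔
      PP A m N w ∧ ¬ m + 1 < w (m + 1) := by
  have ha0 := hA a₀ ha
  have hs : ∀ x, x ≠ a₀ → x ≠ m + 1 → (w * swap a₀ (m + 1)) x = w x := by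
    intro x h1 h2
    simp [Perm.mul_apply, swap_apply_of_ne_of_ne h1 h2]
  have hs1 : (w * swap a₀ (m + 1)) a₀ = w (m + 1) := by simp
  have hs2 : (w * swap a₀ (m + 1)) (m + 1) = w a₀ := by simp
  constructor
  · rintro ⟨h1, h2, h3, h4⟩
    generalize hv : w * swap a₀ (m + 1) = v at *
    have f1 : v a₀ = a₀ := by
      by_contra h
      have := h2 _ h
      simp at this
      omega
    have f2 : v (m + 1) = m + 1 := by
      by_contra h
      have := h2 _ h
      simp at this
      have := hA _ this.2
      omega
    have g1 : w (m + 1) = a₀ := by omega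
    have g2 : w a₀ = m + 1 := by omega
    refine ⟨⟨?_, ?_, ?_, ?_⟩, by omega⟩
    · intro x
      by_cases e1 : x = a₀
      · subst e1; rw [g2, g1]
      by_cases e2 : x = m + 1
      · subst e2; rw [g1, g2]
      rw [← hs x e1 e2, ← hs, h1]
      · intro e; exact e1 (v.injective (e.trans f1.symm))
      · intro e; exact e2 (v.injective (e.trans f2.symm))
    · intro x hx
      by_cases e1 : x = a₀
      · subst e1; exact Or.inl ha
      by_cases e2 : x = m + 1
      · subst e2; right; omega
      rw [← hs x e1 e2] at hx
      rcases h2 x hx with h | h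
      · exact Or.inl (Finset.mem_of_mem_erase h)
      · right; omega
    · intro a haA
      by_cases e1 : a = a₀
      · subst e1; omega
      have := hA a haA
      rw [← hs a e1 (by omega)]
      have := h3 a (Finset.mem_erase.2 ⟨e1, haA⟩)
      omega
    · intro x b hb hxb hbw
      by_cases b2 : b = m + 1
      · subst b2; omega
      by_cases b1 : b = a₀
      · subst b1
        have : w x = x := by
          rw [← hs x (by omega) (by omega)]
          by_contra h
          rcases h2 x h with h' | h'
          · have := hmin x (Finset.mem_of_mem_erase h'); omega
          · omega
        omega
      have hbS : b ∈ A.erase a₀ ∨ (m + 1 < b ∧ b ≤ N) := by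
        rcases hb with h | h
        · exact Or.inl (Finset.mem_erase.2 ⟨b1, h⟩)
        · right; omega
      by_cases x2 : x = m + 1
      · subst x2; omega
      by_cases x1 : x = a₀
      · subst x1
        rcases hbS with h | h
        · have := h3 b h
          rw [hs b b1 b2] at this
          omega
        · omega
      rw [← hs b b1 b2] at hbw ⊢
      rw [← hs x x1 x2]
      exact h4 x b hbS hxb hbw
  · rintro ⟨⟨h1, h2, h3, h4⟩, h5⟩
    have g1 : w a₀ = m + 1 := by
      by_contra hne
      have k1 := h3 a₀ ha
      rcases Nat.lt_or_ge (w (m + 1)) (m + 1) with h | h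
      · have hj : w (m + 1) ∈ A := by
          have := h2 (w (m + 1)) (by rw [h1]; omega)
          rcases this with h' | h'
          · exact h'
          · omega
        have k2 := hmin _ hj
        have k3 : a₀ ≠ w (m + 1) := by
          intro e; apply hne; rw [e, h1]
        have := h4 a₀ (w (m + 1)) (Or.inl hj) (by omega) (by rw [h1]; omega)
        rw [h1] at this
        omega
      · have := h4 a₀ (m + 1) (Or.inr ⟨by omega, hN⟩) (by omega) h
        omega
    have g2 : w (m + 1) = a₀ := by rw [← g1, h1]
    generalize hv : w * swap a₀ (m + 1) = v at *
    rw [g2] at hs1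
    rw [g1] at hs2
    have hmem : ∀ b, (b ∈ A.erase a₀ ∨ (m + 1 < b ∧ b ≤ N)) → b ≠ a₀ ∧ b ≠ m + 1 ∧
        (b ∈ A ∨ (m < b ∧ b ≤ N)) := by
      intro b hb
      rcases hb with h | h
      · obtain ⟨h, h'⟩ := Finset.mem_erase.1 h
        have := hA b h'
        exact ⟨h, by omega, Or.inl h'⟩
      · exact ⟨by omega, by omega, by omega⟩
    refine ⟨?_, ?_, ?_, ?_⟩
    · intro x
      by_cases e1 : x = a₀
      · subst e1; rw [hs1, hs1]
      by_cases e2 : x = m + 1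
      · subst e2; rw [hs2, hs2]
      rw [hs x e1 e2, hs, h1]
      · intro e; exact e2 (w.injective (e.trans g2.symm))
      · intro e; exact e1 (w.injective (e.trans g1.symm))
    · intro x hx
      have e1 : x ≠ a₀ := by rintro rfl; exact hx hs1
      have e2 : x ≠ m + 1 := by rintro rfl; exact hx hs2
      rw [hs x e1 e2] at hx
      rcases h2 x hx with h | h
      · exact Or.inl (Finset.mem_erase.2 ⟨e1, h⟩)
      · right; omega
    · intro a haA
      obtain ⟨k1, k2, -⟩ := hmem a (Or.inl haA)
      rw [hs a k1 k2]
      have := h3 a (Finset.mem_of_mem_erase haA)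
      have : w a ≠ m + 1 := fun e => k1 (w.injective (e.trans g1.symm))
      omega
    · intro x b hb hxb hbw
      obtain ⟨k1, k2, k3⟩ := hmem b hb
      by_cases x1 : x = a₀
      · subst x1; omega
      by_cases x2 : x = m + 1
      · subst x2; omega
      rw [hs b k1 k2] at hbw ⊢
      rw [hs x x1 x2]
      exact h4 x b k3 hxb hbw

theorem PP_count (n : ℕ) : ∀ (m : ℕ) (A : Finset ℕ), (∀ a ∈ A, a ≤ m) →
    {w | PP A m (m + n) w}.encard = (gcount n A.card : ℕ∞) := by
  induction n with
  | zero =>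
    intro m A hA
    rcases A.eq_empty_or_nonempty with rfl | ⟨a, ha⟩
    · have : {w | PP ∅ m (m + 0) w} = {1} := by
        ext w
        simp only [Set.mem_ofPred_eq, Set.mem_singleton_iff]
        constructor
        · rintro ⟨h1, h2, h3, h4⟩
          ext x
          by_contra h
          have := h2 x h
          simp at this
          omega
        · rintro rfl
          refine ⟨by simp, by simp, by simp, ?_⟩
          intro a b _ h _
          simpa using h.le
      rw [this]
      simp [gcount]
    · have : {w | PP A m (m + 0) w} = ∅ := by
        ext w
        simp only [Set.mem_ofPred_eq, Set.mem_empty_iff_false, iff_false]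
        rintro ⟨h1, h2, h3, h4⟩
        have k1 := h3 a ha
        have k2 := hA a ha
        have := h2 (w a) (by rw [h1]; omega)
        rcases this with h | h
        · have := hA _ h; omega
        · omega
      rw [this]
      obtain ⟨c, hc⟩ := Nat.exists_eq_succ_of_ne_zero (Finset.card_ne_zero_of_mem ha)
      rw [hc]
      simp [gcount]
  | succ n ih =>
    intro m A hA
    have hE : m + (n + 1) = (m + 1) + n := by omega
    have split : {w | PP A m (m + (n + 1)) w} =
        {w | PP A m (m + (n + 1)) w ∧ m + 1 < w (m + 1)} ∪
        {w | PP A m (m + (n + 1)) w ∧ ¬ m + 1 < w (m + 1)} := by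
      ext w
      simp only [Set.mem_ofPred_eq, Set.mem_union]
      tauto
    have disj : Disjoint {w | PP A m (m + (n + 1)) w ∧ m + 1 < w (m + 1)}
        {w | PP A m (m + (n + 1)) w ∧ ¬ m + 1 < w (m + 1)} := by
      rw [Set.disjoint_left]
      rintro w ⟨_, h⟩ ⟨_, h'⟩
      exact h' h
    have hc1 : {w | PP A m (m + (n + 1)) w ∧ m + 1 < w (m + 1)}.encard =
        (gcount n (A.card + 1) : ℕ∞) := by
      have hnot : m + 1 ∉ A := fun h => by have := hA _ h; omega
      rw [← Finset.card_insert_of_notMem hnot, ← ih (m + 1) (insert (m + 1) A)]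
      · congr 1
        ext w
        simp only [Set.mem_ofPred_eq]
        rw [← hE]
        exact (PP_open (by omega) w hA).symm
      · intro a ha
        rcases Finset.mem_insert.1 ha with rfl | h
        · exact le_rfl
        · have := hA a h; omega
    rw [split, Set.encard_union_eq disj, hc1]
    rcases A.eq_empty_or_nonempty with rfl | hne
    · have hc2 : {w | PP ∅ m (m + (n + 1)) w ∧ ¬ m + 1 < w (m + 1)}.encard =
          (gcount n 0 : ℕ∞) := by
        rw [← Finset.card_empty (α := ℕ), ← ih (m + 1) ∅ (by simp)]
        congr 1
        ext w
        simp only [Set.mem_ofPred_eq]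
        rw [← hE]
        exact (PP_fix (by omega) w).symm
      rw [hc2]
      simp [gcount]
    · obtain ⟨a₀, ha, hmin⟩ : ∃ a₀ ∈ A, ∀ a ∈ A, a₀ ≤ a :=
        ⟨A.min' hne, A.min'_mem hne, fun a h => A.min'_le a h⟩
      have hc2 : {w | PP A m (m + (n + 1)) w ∧ ¬ m + 1 < w (m + 1)}.encard =
          (gcount n (A.erase a₀).card : ℕ∞) := by
        rw [← ih (m + 1) (A.erase a₀) (fun a h => by
          have := hA a (Finset.mem_of_mem_erase h); omega)]
        rw [← (mul_left_injective (swap a₀ (m + 1))).encard_image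
          {w | PP A m (m + (n + 1)) w ∧ ¬ m + 1 < w (m + 1)}]
        congr 1
        ext v
        simp only [Set.mem_ofPred_eq, Set.mem_image]
        rw [← hE]
        constructor
        · rintro ⟨w, hw, rfl⟩
          exact (PP_close (by omega) w hA ha hmin).2 hw
        · intro hv
          refine ⟨v * swap a₀ (m + 1), ?_, by simp [mul_assoc]⟩
          apply (PP_close (by omega) _ hA ha hmin).1
          simpa [mul_assoc] using hv
      have hcard : A.card = (A.erase a₀).card + 1 := (Finset.card_erase_add_one ha).symm
      rw [hc2, hcard]
      simp [gcount]

theorem PP_iff (n : ℕ) (w : Equiv.Perm ℕ) :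
    (IsInvolutionOn n w ∧ Avoids321 n w) ↔ PP ∅ 0 (0 + n) w := by
  unfold PP IsInvolutionOn Avoids321
  simp only [Finset.notMem_empty, false_or, false_imp_iff, implies_true, true_and, zero_add]
  constructor
  · rintro ⟨⟨h1, h2⟩, h3⟩
    have hi : ∀ x, w (w x) = x := fun x => by
      rw [← Perm.mul_apply, h2]; rfl
    refine ⟨hi, fun x hx => by have := h1 x hx; omega, ?_⟩
    intro a b hb hab hbw
    by_contra hlt
    have ea := h1 a (by omega)
    have ea' := h1 (w a) (by rw [hi]; omega)
    -- the pattern sits at positions a < b < w a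
    apply h3 a b (w a) ea.1 hab (by omega) ea'.2
    rw [hi]
    omega
  · rintro ⟨hi, h2, h4⟩
    refine ⟨⟨fun x hx => by have := h2 x hx; omega, by ext x; simp [hi]⟩, ?_⟩
    intro p q r hp hpq hqr hr ⟨k1, k2⟩
    rcases Nat.lt_or_ge (w q) q with h | h
    · -- q is a closer
      by_cases hwr : w r = 0
      · have : r = 0 := by
          have h0 : w 0 = 0 := by
            by_contra h'
            have := h2 0 h'
            omega
          exact w.injective (hwr.trans h0.symm)
        omega
      have e := h4 (w r) (w q) (by omega) k2 (by rw [hi]; omega)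
      rw [hi, hi] at e
      omega
    · have := h4 p q (by omega) hpq h
      omega

/-- The number of 321-avoiding involutions in `S_n` is the central binomial coefficient
`C(n, ⌊n/2⌋)`. -/
theorem mi_eq_central_binomial (n : ℕ) (hn : 1 ≤ n) :
    mi n = Nat.choose n (n / 2) := by
  have h := PP_count n 0 ∅ (by simp)
  unfold mi Set.ncard
  simp only [PP_iff]
  rw [h, gcount_eq]
  simp
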